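/- Let n ∈ ℕ and k > 0 with 2^{k+1} ≤ n. Then 𝒢_k(n) = O(n) (i.e. f_k(f_k(λ)) = f_{k+1}(λ) for every odd partition λ of n) if and only if n = 2^{k+1} + m with m < 2^k, that is, if and only if ⌊n/2^k⌋ = 2. -/

import Mathlib

namespace OddSym

open scoped Classical

/-- Remove one box from a row of size `p` (as multisets of parts). -/
def removeBox (lam : Multiset ℕ) (p : ℕ) : Multiset ℕ :=
  if p ≤ 1 then lam.erase p else (p - 1) ::ₘ lam.erase p

lemma removeBox_sum_lt {lam : Multiset ℕ} {p : ℕ} (hp : p ∈ lam) (h0 : 0 < p) :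
    (removeBox lam p).sum < lam.sum := by
  have h : p + (lam.erase p).sum = lam.sum := by
    conv_rhs => rw [← Multiset.cons_erase hp]
    simp [Multiset.sum_cons]
  unfold removeBox
  split
  · omega
  · simp only [Multiset.sum_cons]
    omega

/-- The number of standard Young tableaux of shape `lam`
(equivalently, the degree of the irreducible character of the symmetric
group labelled by `lam`), defined via the branching rule. -/
def degSYT (lam : Multiset ℕ) : ℕ :=
  if _h : lam = 0 then 1
  else ∑ p ∈ (lam.toFinset.filter (fun p => 0 < p)).attach, degSYT (removeBox lam p.1)
termination_by lam.sum
decreasing_by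
  have hp := p.2
  simp only [Finset.mem_filter, Multiset.mem_toFinset] at hp
  exact removeBox_sum_lt hp.1 hp.2

/-- `lam` is an odd partition: all parts positive and the number of standard
Young tableaux of shape `lam` (= the character degree) is odd. -/
def OddP (lam : Multiset ℕ) : Prop :=
  (∀ x ∈ lam, 0 < x) ∧ Odd (degSYT lam)

/-- The parts of `lam` sorted in weakly decreasing order. -/
def descList (lam : Multiset ℕ) : List ℕ :=
  (lam.sort (· ≤ ·)).reverse

/-- The beta-set (set of beta-numbers) of `lam` with `m` beads:
`{ lam_i + (m - i) : 1 ≤ i ≤ m }` where `lam` is padded with zero parts. -/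
def betaSet (lam : Multiset ℕ) (m : ℕ) : Finset ℕ :=
  (Finset.range m).image (fun i => (descList lam).getD i 0 + (m - 1 - i))

/-- `mu` is obtained from `lam` by removing an `e`-hook: in some beta-set of
`lam` a beta-number `x` is replaced by `x - e` (which is not a beta-number). -/
def IsHookRemoval (e : ℕ) (lam mu : Multiset ℕ) : Prop :=
  (∀ x ∈ lam, 0 < x) ∧ (∀ x ∈ mu, 0 < x) ∧ 0 < e ∧
  ∃ m x, Multiset.card lam ≤ m ∧ Multiset.card mu ≤ m ∧
    x ∈ betaSet lam m ∧ e ≤ x ∧ x - e ∉ betaSet lam m ∧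
    betaSet mu m = insert (x - e) ((betaSet lam m).erase x)

/-- The map `f_k` : for an odd partition `lam` with `2^k ≤ |lam|`, the unique
odd partition obtained from `lam` by removing a `2^k`-hook (junk value `0` if
no such partition exists). -/
noncomputable def fkOp (k : ℕ) (lam : Multiset ℕ) : Multiset ℕ :=
  if h : ∃ mu, IsHookRemoval (2 ^ k) lam mu ∧ OddP mu then h.choose else 0

/-- The partition encoded by a finite beta-set: each bead contributes a part
equal to the number of gaps below it. -/
def partOfBeta (S : Finset ℕ) : Multiset ℕ :=
  (S.val.map (fun b => b - (S.filter (fun a => a < b)).card)).filter (fun p => 0 < p)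

/-- The 2-quotient `(lam_0, lam_1)` of `lam`, computed from a beta-set with an
even number of beads via the two runners of the 2-abacus. -/
def quot2 (lam : Multiset ℕ) : Multiset ℕ × Multiset ℕ :=
  (partOfBeta (((betaSet lam (2 * Multiset.card lam)).filter (fun b => b % 2 = 0)).image
      (fun b => b / 2)),
   partOfBeta (((betaSet lam (2 * Multiset.card lam)).filter (fun b => b % 2 = 1)).image
      (fun b => b / 2)))

/-- The `e`-core of `lam`: push all beads of an `e`-abacus configuration for
`lam` up as far as possible. -/
def coreP (e : ℕ) (lam : Multiset ℕ) : Multiset ℕ :=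
  partOfBeta ((Finset.range (e * (Multiset.card lam + e))).filter
    (fun x => x / e <
      ((betaSet lam (Multiset.card lam + e)).filter (fun b => b % e = x % e)).card))

/-- Row `k` of the 2-quotient tower of `lam`: row 0 is `[lam]`, and row `k+1`
replaces each entry of row `k` by its 2-quotient pair. -/
def towerRow : ℕ → Multiset ℕ → List (Multiset ℕ)
  | 0, lam => [lam]
  | (k + 1), lam => (towerRow k lam).flatMap (fun mu => [(quot2 mu).1, (quot2 mu).2])

/-- `R_k^j(lam)`: the component of row `k` of the 2-quotient tower of `lam`
from which a `2^(j-k)`-hook is removed in the passage from `lam` to `f_j(lam)`;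
it is characterized by: row `k` for `f_j(lam)` is obtained from row `k` for
`lam` by replacing this component by its image under `f_(j-k)`. -/
noncomputable def Rcomp (k j : ℕ) (lam : Multiset ℕ) : Multiset ℕ :=
  if h : ∃ s, s < 2 ^ k ∧
      towerRow k (fkOp j lam) =
        (towerRow k lam).set s (fkOp (j - k) ((towerRow k lam).getD s 0))
  then (towerRow k lam).getD h.choose 0 else 0

/-- The set of beads obtained from `S` by sliding the bead `x` down to `x - e`. -/
def moveBead (S : Finset ℕ) (e x : ℕ) : Finset ℕ :=
  insert (x - e) (S.erase x)

lemma descList_cons {p : ℕ} {lam : Multiset ℕ} (h : ∀ q ∈ lam, q ≤ p) :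
    descList (p ::ₘ lam) = p :: descList lam := by
  apply List.Perm.eq_of_pairwise (le := fun a b : ℕ => b ≤ a)
  · intro a b _ _ h1 h2
    exact le_antisymm h2 h1
  · exact List.pairwise_reverse.2 (Multiset.pairwise_sort _ _)
  · refine List.pairwise_cons.2 ⟨?_, List.pairwise_reverse.2 (Multiset.pairwise_sort _ _)⟩
    intro a ha
    exact h a (by simpa [descList] using ha)
  · rw [← Multiset.coe_eq_coe]
    simp [descList, ← Multiset.cons_coe]

lemma betaSet_zero (m : ℕ) : betaSet 0 m = Finset.range m := by
  ext b
  simp only [betaSet, descList, Multiset.sort_zero, List.reverse_nil, List.getD_nil, zero_add,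
    Finset.mem_image, Finset.mem_range]
  constructor
  · rintro ⟨i, hi, rfl⟩
    omega
  · intro hb
    exact ⟨m - 1 - b, by omega, by omega⟩

lemma betaSet_cons {p : ℕ} {lam : Multiset ℕ} (h : ∀ q ∈ lam, q ≤ p) (m : ℕ) :
    betaSet (p ::ₘ lam) (m + 1) = insert (p + m) (betaSet lam m) := by
  rw [betaSet, descList_cons h, Finset.range_add_one', Finset.image_insert, Finset.map_eq_image,
    Finset.image_image, betaSet]
  congr 1
  refine Finset.image_congr fun i _ => ?_
  change (p :: descList lam).getD (i + 1) 0 + (m + 1 - 1 - (i + 1)) = _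
  rw [List.getD_cons_succ]
  omega

lemma lt_of_mem_betaSet {p : ℕ} {lam : Multiset ℕ} (h : ∀ q ∈ lam, q ≤ p) {m b : ℕ}
    (hb : b ∈ betaSet lam m) : b < p + m := by
  simp only [betaSet, Finset.mem_image, Finset.mem_range] at hb
  obtain ⟨i, hi, rfl⟩ := hb
  have : (descList lam).getD i 0 ≤ p := by
    rcases lt_or_ge i (descList lam).length with hl | hl
    · rw [List.getD_eq_getElem _ _ hl]
      have hmem : (descList lam)[i] ∈ descList lam := List.getElem_mem hl
      generalize (descList lam)[i] = a at hmem ⊢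
      exact h _ (by simpa [descList] using hmem)
    · rw [List.getD_eq_default _ _ hl]
      exact Nat.zero_le _
  omega

lemma card_le_of_forall_lt {S : Finset ℕ} {c : ℕ} (h : ∀ b ∈ S, b < c) : S.card ≤ c := by
  simpa using Finset.card_le_card (fun b hb => Finset.mem_range.2 (h b hb) : S ⊆ Finset.range c)

lemma partOfBeta_insert_max {S : Finset ℕ} {c : ℕ} (h : ∀ b ∈ S, b < c) :
    partOfBeta (insert c S) =
      if 0 < c - S.card then (c - S.card) ::ₘ partOfBeta S else partOfBeta S := by
  have hc : c ∉ S := fun hc => lt_irrefl _ (h c hc)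
  have h1 : (insert c S).filter (fun a => a < c) = S := by
    ext a
    simp only [Finset.mem_filter, Finset.mem_insert]
    grind
  have h2 : ∀ b ∈ S.val, b - ((insert c S).filter (fun a => a < b)).card =
      b - (S.filter (fun a => a < b)).card := by
    intro b hb
    congr 2
    have := h b hb
    ext a
    simp only [Finset.mem_filter, Finset.mem_insert]
    grind
  rw [partOfBeta, Finset.insert_val_of_notMem hc, Multiset.map_cons, h1, Multiset.map_congr rfl h2,
    Multiset.filter_cons, partOfBeta]
  split_ifs <;> simp

lemma partOfBeta_range (m : ℕ) : partOfBeta (Finset.range m) = 0 := by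
  induction m with
  | zero => rfl
  | succ m ih =>
    rw [Finset.range_add_one, partOfBeta_insert_max (fun b hb => Finset.mem_range.1 hb), ih]
    simp

lemma pos_of_mem_partOfBeta {S : Finset ℕ} {p : ℕ} (h : p ∈ partOfBeta S) : 0 < p :=
  (Multiset.mem_filter.1 h).2

lemma partOfBeta_le_of_forall_lt {S : Finset ℕ} {c : ℕ} (h : ∀ b ∈ S, b < c) :
    ∀ q ∈ partOfBeta S, q ≤ c - S.card := by
  induction S using Finset.induction_on_max generalizing c with
  | empty => simp [partOfBeta]
  | insert a S ha ih =>
    have hac := h a (Finset.mem_insert_self _ _)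
    have haS : a ∉ S := fun hc => lt_irrefl _ (ha a hc)
    intro q hq
    rw [partOfBeta_insert_max ha] at hq
    rw [Finset.card_insert_of_notMem haS]
    have := ih ha q
    split_ifs at hq
    · rcases Multiset.mem_cons.1 hq with rfl | hq
      · omega
      · have := this hq
        omega
    · have := this hq
      omega

lemma card_betaSet_and_partOfBeta_betaSet {lam : Multiset ℕ} {m : ℕ} (hpos : ∀ x ∈ lam, 0 < x)
    (hm : Multiset.card lam ≤ m) :
    (betaSet lam m).card = m ∧ partOfBeta (betaSet lam m) = lam := by
  induction m generalizing lam with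
  | zero =>
    obtain rfl : lam = 0 := by simpa using hm
    rw [betaSet_zero]
    exact ⟨rfl, partOfBeta_range 0⟩
  | succ m ih =>
    by_cases h0 : lam = 0
    · subst h0
      rw [betaSet_zero, partOfBeta_range]
      simp
    · obtain ⟨p, hp, hmax⟩ := lam.toFinset.exists_max_image id
        (by simpa [Finset.nonempty_iff_ne_empty] using h0)
      simp only [Multiset.mem_toFinset, id] at hp hmax
      obtain ⟨mu, rfl⟩ := Multiset.exists_cons_of_mem hp
      have hmax' : ∀ q ∈ mu, q ≤ p := fun q hq => hmax q (Multiset.mem_cons_of_mem hq)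
      obtain ⟨h1, h2⟩ := ih (lam := mu) (fun x hx => hpos x (Multiset.mem_cons_of_mem hx))
        (by simpa using hm)
      have hlt : ∀ b ∈ betaSet mu m, b < p + m := fun b hb => lt_of_mem_betaSet hmax' hb
      have hnot : p + m ∉ betaSet mu m := fun hc => lt_irrefl _ (hlt _ hc)
      have hp0 := hpos p hp
      rw [betaSet_cons hmax', Finset.card_insert_of_notMem hnot, partOfBeta_insert_max hlt, h1, h2]
      simp [hp0]

lemma partOfBeta_betaSet {lam : Multiset ℕ} {m : ℕ} (hpos : ∀ x ∈ lam, 0 < x)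
    (hm : Multiset.card lam ≤ m) : partOfBeta (betaSet lam m) = lam :=
  (card_betaSet_and_partOfBeta_betaSet hpos hm).2

lemma betaSet_partOfBeta (S : Finset ℕ) : betaSet (partOfBeta S) S.card = S := by
  induction S using Finset.induction_on_max with
  | empty => rfl
  | insert a S ha ih =>
    have haS : a ∉ S := fun hc => lt_irrefl _ (ha a hc)
    have hle := card_le_of_forall_lt ha
    have hq := partOfBeta_le_of_forall_lt ha
    rw [partOfBeta_insert_max ha, Finset.card_insert_of_notMem haS]
    split_ifs with h
    · rw [betaSet_cons hq, ih]
      congr 1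
      omega
    · have h0 : partOfBeta S = 0 := by
        refine Multiset.eq_zero_of_forall_notMem fun q hq' => ?_
        have := hq q hq'
        have := pos_of_mem_partOfBeta hq'
        omega
      have hS : S = Finset.range S.card := by rw [← betaSet_zero, ← h0, ih]
      have hac : a = S.card := by omega
      rw [h0, betaSet_zero, Finset.range_add_one, ← hS, ← hac]

lemma partOfBeta_injective {S T : Finset ℕ} (hc : S.card = T.card)
    (h : partOfBeta S = partOfBeta T) : S = T := by
  rw [← betaSet_partOfBeta S, ← betaSet_partOfBeta T, h, hc]

lemma card_partOfBeta_le (S : Finset ℕ) : Multiset.card (partOfBeta S) ≤ S.card := by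
  refine (Multiset.card_le_card (Multiset.filter_le _ _)).trans ?_
  simp

lemma sum_partOfBeta (S : Finset ℕ) :
    (partOfBeta S).sum + S.card.choose 2 = ∑ b ∈ S, b := by
  induction S using Finset.induction_on_max with
  | empty => rfl
  | insert a S ha ih =>
    have haS : a ∉ S := fun hc => lt_irrefl _ (ha a hc)
    have hle := card_le_of_forall_lt ha
    rw [partOfBeta_insert_max ha, Finset.card_insert_of_notMem haS, Finset.sum_insert haS, ← ih,
      Nat.choose_succ_succ' _ 1, Nat.choose_one_right, one_add_one_eq_two]
    split_ifs with h
    · rw [Multiset.sum_cons]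
      omega
    · omega

/-- The beads of `S` that can be slid down by `e`. -/
def movable (S : Finset ℕ) (e : ℕ) : Finset ℕ :=
  S.filter (fun x => e ≤ x ∧ x - e ∉ S)

lemma mem_movable {S : Finset ℕ} {e x : ℕ} : x ∈ movable S e ↔ x ∈ S ∧ e ≤ x ∧ x - e ∉ S :=
  Finset.mem_filter

lemma card_moveBead {S : Finset ℕ} {e x : ℕ} (hx : x ∈ movable S e) :
    (moveBead S e x).card = S.card := by
  obtain ⟨h1, -, h3⟩ := mem_movable.1 hx
  rw [moveBead, Finset.card_insert_of_notMem (fun h => h3 (Finset.mem_of_mem_erase h)),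
    Finset.card_erase_add_one h1]

lemma sum_moveBead {S : Finset ℕ} {e x : ℕ} (hx : x ∈ movable S e) :
    (∑ b ∈ moveBead S e x, b) + e = ∑ b ∈ S, b := by
  obtain ⟨h1, h2, h3⟩ := mem_movable.1 hx
  rw [moveBead, Finset.sum_insert (fun h => h3 (Finset.mem_of_mem_erase h)),
    ← Finset.add_sum_erase S _ h1]
  omega

lemma sum_partOfBeta_moveBead {S : Finset ℕ} {e x : ℕ} (hx : x ∈ movable S e) :
    (partOfBeta (moveBead S e x)).sum + e = (partOfBeta S).sum := by
  have h1 := sum_partOfBeta (moveBead S e x)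
  have h2 := sum_partOfBeta S
  have h3 := sum_moveBead hx
  rw [card_moveBead hx] at h1
  omega

/-- The number of gaps of `S` below `b`. -/
def gapsBelow (S : Finset ℕ) (b : ℕ) : ℕ :=
  (Finset.range b \ S).card

lemma sub_card_filter_lt (S : Finset ℕ) (b : ℕ) :
    b - (S.filter (fun a => a < b)).card = gapsBelow S b := by
  rw [gapsBelow, Finset.card_sdiff, Finset.card_range]
  congr 2
  ext a
  simp

lemma partOfBeta_eq (S : Finset ℕ) :
    partOfBeta S = (S.val.map (gapsBelow S)).filter (fun p => 0 < p) := by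
  simp only [partOfBeta, sub_card_filter_lt]

lemma gapsBelow_moveBead_one_of_ne {S : Finset ℕ} {x a : ℕ} (hx : x ∈ movable S 1) (ha : a ∈ S)
    (hax : a ≠ x) : gapsBelow (moveBead S 1 x) a = gapsBelow S a := by
  obtain ⟨h1, h2, h3⟩ := mem_movable.1 hx
  rw [← sub_card_filter_lt, ← sub_card_filter_lt]
  congr 1
  have ha1 : a ≠ x - 1 := fun h => h3 (h ▸ ha)
  rcases lt_or_gt_of_ne hax with h | h
  · congr 1
    ext c
    simp only [moveBead, Finset.mem_filter, Finset.mem_insert, Finset.mem_erase]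
    constructor
    · rintro ⟨h4 | h4, h5⟩
      · omega
      · exact ⟨h4.2, h5⟩
    · rintro ⟨h4, h5⟩
      exact ⟨Or.inr ⟨by omega, h4⟩, h5⟩
  · rw [moveBead, Finset.filter_insert, if_pos (by omega), Finset.filter_erase,
      Finset.card_insert_of_notMem, Finset.card_erase_add_one]
    · simp [h1, h]
    · simp [h3]

lemma gapsBelow_moveBead_one_self {S : Finset ℕ} {x : ℕ} (hx : x ∈ movable S 1) :
    gapsBelow (moveBead S 1 x) (x - 1) + 1 = gapsBelow S x := by
  obtain ⟨h1, h2, h3⟩ := mem_movable.1 hx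
  have h : Finset.range x \ S = insert (x - 1) (Finset.range (x - 1) \ moveBead S 1 x) := by
    ext c
    simp only [moveBead, Finset.mem_sdiff, Finset.mem_insert, Finset.mem_erase, Finset.mem_range]
    constructor
    · rintro ⟨h4, h5⟩
      by_cases h6 : c = x - 1
      · exact Or.inl h6
      · exact Or.inr ⟨by omega, by tauto⟩
    · rintro (rfl | ⟨h4, h5⟩)
      · exact ⟨by omega, h3⟩
      · refine ⟨by omega, fun h6 => h5 (Or.inr ⟨by omega, h6⟩)⟩
  rw [gapsBelow, gapsBelow, h, Finset.card_insert_of_notMem (by simp)]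

lemma removeBox_partOfBeta {S : Finset ℕ} {x : ℕ} (hx : x ∈ movable S 1) :
    removeBox (partOfBeta S) (gapsBelow S x) = partOfBeta (moveBead S 1 x) := by
  obtain ⟨h1, h2, h3⟩ := mem_movable.1 hx
  have hself := gapsBelow_moveBead_one_self hx
  have hS : S.val = x ::ₘ (S.erase x).val := by
    rw [Finset.erase_val, Multiset.cons_erase h1]
  have hcongr : (S.erase x).val.map (gapsBelow (moveBead S 1 x)) =
      (S.erase x).val.map (gapsBelow S) := by
    refine Multiset.map_congr rfl fun a ha => ?_
    have ha' : a ∈ S.erase x := ha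
    exact gapsBelow_moveBead_one_of_ne hx (Finset.mem_of_mem_erase ha')
      (Finset.ne_of_mem_erase ha')
  have hM : (moveBead S 1 x).val = (x - 1) ::ₘ (S.erase x).val :=
    Finset.insert_val_of_notMem fun h => h3 (Finset.mem_of_mem_erase h)
  rw [partOfBeta_eq S, partOfBeta_eq (moveBead S 1 x), hM, Multiset.map_cons, hcongr, hS,
    Multiset.map_cons, Multiset.filter_cons_of_pos _ (by omega), removeBox,
    Multiset.erase_cons_head, Multiset.filter_cons]
  split_ifs with h4 h5 h5
  · omega
  · simp
  · have h6 : gapsBelow (moveBead S 1 x) (x - 1) = gapsBelow S x - 1 := by omega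
    rw [h6, Multiset.singleton_add]
  · omega

lemma gapsBelow_lt_gapsBelow {S : Finset ℕ} {x y : ℕ} (hx : x ∈ S) (hy : y ∈ movable S 1)
    (hxy : x < y) : gapsBelow S x < gapsBelow S y := by
  obtain ⟨h1, h2, h3⟩ := mem_movable.1 hy
  have hne : x ≠ y - 1 := fun h => h3 (h ▸ hx)
  refine Finset.card_lt_card ((Finset.ssubset_iff_of_subset ?_).2 ⟨y - 1, ?_, ?_⟩)
  · exact Finset.sdiff_subset_sdiff (Finset.range_mono hxy.le) subset_rfl
  · simp only [Finset.mem_sdiff, Finset.mem_range]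
    exact ⟨by omega, h3⟩
  · simp only [Finset.mem_sdiff, Finset.mem_range]
    omega

lemma degSYT_partOfBeta {S : Finset ℕ} (h : partOfBeta S ≠ 0) :
    degSYT (partOfBeta S) = ∑ x ∈ movable S 1, degSYT (partOfBeta (moveBead S 1 x)) := by
  rw [degSYT, dif_neg h, Finset.sum_attach _ (fun p => degSYT (removeBox (partOfBeta S) p))]
  symm
  refine Finset.sum_nbij (gapsBelow S) ?_ ?_ ?_ ?_
  · intro x hx
    have hself := gapsBelow_moveBead_one_self hx
    have hpos : 0 < gapsBelow S x := by omega
    simp only [Finset.mem_filter, Multiset.mem_toFinset]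
    refine ⟨?_, hpos⟩
    rw [partOfBeta_eq]
    exact Multiset.mem_filter.2 ⟨Multiset.mem_map_of_mem _ (mem_movable.1 hx).1, hpos⟩
  · intro x hx y hy hxy
    by_contra hne
    rcases lt_or_gt_of_ne hne with hlt | hlt
    · exact (gapsBelow_lt_gapsBelow (mem_movable.1 hx).1 hy hlt).ne hxy
    · exact (gapsBelow_lt_gapsBelow (mem_movable.1 hy).1 hx hlt).ne' hxy
  · intro p hp
    simp only [Finset.coe_filter, Multiset.mem_toFinset, Set.mem_ofPred_eq] at hp
    obtain ⟨hp, hpos⟩ := hp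
    rw [partOfBeta_eq] at hp
    obtain ⟨b, hb, hbp⟩ := Multiset.mem_map.1 (Multiset.mem_filter.1 hp).1
    obtain ⟨c, hc, hmin⟩ := (S.filter (fun b => gapsBelow S b = p)).exists_min_image id
      ⟨b, Finset.mem_filter.2 ⟨hb, hbp⟩⟩
    obtain ⟨hcS, hcp⟩ := Finset.mem_filter.1 hc
    refine ⟨c, ?_, hcp⟩
    have hc1 : 1 ≤ c := by
      by_contra hc0
      obtain rfl : c = 0 := by omega
      simp [gapsBelow] at hcp
      omega
    refine mem_movable.2 ⟨hcS, hc1, fun hc' => ?_⟩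
    have heq : gapsBelow S (c - 1) = gapsBelow S c := by
      rw [gapsBelow, gapsBelow]
      congr 1
      ext a
      simp only [Finset.mem_sdiff, Finset.mem_range]
      constructor
      · rintro ⟨h1, h2⟩
        exact ⟨by omega, h2⟩
      · rintro ⟨h1, h2⟩
        have : a ≠ c - 1 := fun h => h2 (h ▸ hc')
        exact ⟨by omega, h2⟩
    have := hmin (c - 1) (Finset.mem_filter.2 ⟨hc', heq.trans hcp⟩)
    simp only [id] at this
    omega
  · intro x hx
    rw [removeBox_partOfBeta hx]

lemma sum_sum_eq_sum_diag {ι R : Type*} [CommRing R] [CharP R 2] (s : Finset ι) (f : ι → ι → R)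
    (hf : ∀ i j, f i j = f j i) : ∑ i ∈ s, ∑ j ∈ s, f i j = ∑ i ∈ s, f i i := by
  induction s using Finset.induction_on with
  | empty => simp
  | insert a s ha ih =>
    have h1 : ∑ i ∈ s, f i a = ∑ j ∈ s, f a j := Finset.sum_congr rfl fun i _ => hf i a
    simp only [Finset.sum_insert ha, Finset.sum_add_distrib, ih, h1]
    linear_combination CharTwo.add_self_eq_zero (∑ j ∈ s, f a j)

/-- The set of beads listed by an integer tuple. -/
def beadSet {m : ℕ} (x : Fin m → ℤ) : Finset ℕ :=
  Finset.univ.image (fun i => (x i).toNat)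

/-- The degree modulo 2 attached to a tuple of bead positions, which vanishes on tuples with
repeated or negative entries. -/
noncomputable def tupleDeg {m : ℕ} (x : Fin m → ℤ) : ZMod 2 :=
  if Function.Injective x ∧ ∀ i, 0 ≤ x i then (degSYT (partOfBeta (beadSet x)) : ZMod 2) else 0

lemma tupleDeg_of_neg {m : ℕ} {x : Fin m → ℤ} {i : Fin m} (h : x i < 0) : tupleDeg x = 0 :=
  if_neg fun hx => absurd (hx.2 i) (by omega)

lemma tupleDeg_of_eq {m : ℕ} {x : Fin m → ℤ} {i j : Fin m} (hij : i ≠ j) (h : x i = x j) :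
    tupleDeg x = 0 :=
  if_neg fun hx => hij (hx.1 h)

lemma tupleDeg_comp_perm {m : ℕ} (x : Fin m → ℤ) (σ : Equiv.Perm (Fin m)) :
    tupleDeg (x ∘ σ) = tupleDeg x := by
  have h1 : beadSet (x ∘ σ) = beadSet x := by
    ext b
    simp only [beadSet, Finset.mem_image, Finset.mem_univ, true_and, Function.comp]
    exact σ.surjective.exists (p := fun i => (x i).toNat = b) |>.symm
  have h2 : (∀ i, 0 ≤ (x ∘ σ) i) ↔ ∀ i, 0 ≤ x i :=
    (σ.surjective.forall (p := fun i => 0 ≤ x i)).symm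
  simp only [tupleDeg, h1, h2, EquivLike.injective_comp]

lemma image_update {m : ℕ} {y : Fin m → ℕ} (hy : Function.Injective y) (i : Fin m) (v : ℕ) :
    Finset.univ.image (Function.update y i v) =
      insert v ((Finset.univ.image y).erase (y i)) := by
  ext b
  simp only [Finset.mem_image, Finset.mem_univ, true_and, Finset.mem_insert, Finset.mem_erase]
  constructor
  · rintro ⟨j, rfl⟩
    by_cases hj : j = i
    · subst hj
      simp
    · rw [Function.update_of_ne hj]
      exact Or.inr ⟨fun h => hj (hy h), j, rfl⟩
  · rintro (rfl | ⟨h1, j, rfl⟩)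
    · exact ⟨i, by simp⟩
    · exact ⟨j, Function.update_of_ne (fun h => h1 (congrArg y h)) _ _⟩

lemma beadSet_natCast {m : ℕ} (y : Fin m → ℕ) :
    beadSet (fun i => (y i : ℤ)) = Finset.univ.image y := by
  simp [beadSet]

lemma tupleDeg_natCast {m : ℕ} {y : Fin m → ℕ} (hy : Function.Injective y) :
    tupleDeg (fun i => (y i : ℤ)) = (degSYT (partOfBeta (Finset.univ.image y)) : ZMod 2) := by
  rw [tupleDeg, if_pos, beadSet_natCast]
  exact ⟨Nat.cast_injective.comp hy, fun i => Int.natCast_nonneg _⟩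

lemma tupleDeg_natCast_sub_single {m e : ℕ} (he : 0 < e) {y : Fin m → ℕ}
    (hy : Function.Injective y) (i : Fin m) :
    tupleDeg ((fun i => (y i : ℤ)) - Pi.single i (e : ℤ)) =
      if e ≤ y i ∧ y i - e ∉ Finset.univ.image y then
        (degSYT (partOfBeta (moveBead (Finset.univ.image y) e (y i))) : ZMod 2) else 0 := by
  split_ifs with h
  · obtain ⟨h1, h2⟩ := h
    have hupd : ((fun i => (y i : ℤ)) - Pi.single i (e : ℤ)) =
        fun j => ((Function.update y i (y i - e) j : ℕ) : ℤ) := by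
      ext j
      by_cases hj : j = i
      · subst hj
        simp [Nat.cast_sub h1]
      · simp [hj]
    rw [hupd, tupleDeg_natCast, image_update hy, moveBead]
    intro a b hab
    by_contra hne
    by_cases ha : a = i
    · subst ha
      rw [Function.update_self, Function.update_of_ne (Ne.symm hne)] at hab
      exact h2 (Finset.mem_image.2 ⟨b, Finset.mem_univ _, hab.symm⟩)
    · by_cases hb : b = i
      · subst hb
        rw [Function.update_self, Function.update_of_ne ha] at hab
        exact h2 (Finset.mem_image.2 ⟨a, Finset.mem_univ _, hab⟩)
      · rw [Function.update_of_ne ha, Function.update_of_ne hb] at hab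
        exact hne (hy hab)
  · by_cases h1 : e ≤ y i
    · have h2 : y i - e ∈ Finset.univ.image y := by tauto
      obtain ⟨j, -, hj⟩ := Finset.mem_image.1 h2
      have hji : j ≠ i := by
        rintro rfl
        omega
      refine tupleDeg_of_eq hji ?_
      simp only [Pi.sub_apply, Pi.single_eq_same, Pi.single_eq_of_ne hji, hj]
      omega
    · refine tupleDeg_of_neg (i := i) ?_
      simp only [Pi.sub_apply, Pi.single_eq_same]
      omega

lemma sum_tupleDeg_natCast {m e : ℕ} (he : 0 < e) {y : Fin m → ℕ} (hy : Function.Injective y) :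
    ∑ i, tupleDeg ((fun i => (y i : ℤ)) - Pi.single i (e : ℤ)) =
      ∑ b ∈ movable (Finset.univ.image y) e,
        (degSYT (partOfBeta (moveBead (Finset.univ.image y) e b)) : ZMod 2) := by
  rw [movable, Finset.sum_filter, Finset.sum_image (fun i _ j _ h => hy h)]
  exact Finset.sum_congr rfl fun i _ => tupleDeg_natCast_sub_single he hy i

lemma sum_tupleDeg_sub_single_one {m : ℕ} {x : Fin m → ℤ}
    (hx : ((m.choose 2 : ℕ) : ℤ) + 1 ≤ ∑ i, x i) :
    ∑ i, tupleDeg (x - Pi.single i (1 : ℤ)) = tupleDeg x := by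
  by_cases hneg : ∃ i, x i < 0
  · obtain ⟨i, hi⟩ := hneg
    rw [tupleDeg_of_neg hi]
    refine Finset.sum_eq_zero fun j _ => tupleDeg_of_neg (i := i) ?_
    by_cases hj : i = j
    · subst hj
      simp only [Pi.sub_apply, Pi.single_eq_same]
      omega
    · simpa [Pi.single_eq_of_ne hj] using hi
  push Not at hneg
  by_cases hinj : Function.Injective x
  · lift x to Fin m → ℕ using hneg
    have hy : Function.Injective x := fun a b h => hinj (by simp [h])
    have hcard : (Finset.univ.image x).card = m := by
      rw [Finset.card_image_of_injective _ hy, Finset.card_univ, Fintype.card_fin]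
    have h0 : partOfBeta (Finset.univ.image x) ≠ 0 := by
      intro h0
      have hs := sum_partOfBeta (Finset.univ.image x)
      rw [h0, hcard, Finset.sum_image (fun i _ j _ h => hy h)] at hs
      rw [← Nat.cast_sum, ← hs] at hx
      simp at hx
    have h1 := sum_tupleDeg_natCast one_pos hy
    rw [Nat.cast_one] at h1
    rw [h1, tupleDeg_natCast hy, degSYT_partOfBeta h0, Nat.cast_sum]
  · obtain ⟨i, j, hij, hne⟩ : ∃ i j, x i = x j ∧ i ≠ j := by
      simpa [Function.Injective] using hinj
    rw [tupleDeg_of_eq hne hij, ← Finset.sum_subset (Finset.subset_univ {i, j}),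
      Finset.sum_pair hne]
    · have hswap : x - Pi.single j (1 : ℤ) = (x - Pi.single i (1 : ℤ)) ∘ Equiv.swap i j := by
        ext a
        simp only [Function.comp, Pi.sub_apply]
        by_cases hai : a = i
        · subst hai
          simp [hij, hne, hne.symm]
        · by_cases haj : a = j
          · subst haj
            simp [hij]
          · simp [Equiv.swap_apply_of_ne_of_ne hai haj, hai, haj]
      rw [hswap, tupleDeg_comp_perm, CharTwo.add_self_eq_zero]
    · intro a _ ha
      simp only [Finset.mem_insert, Finset.mem_singleton, not_or] at ha
      refine tupleDeg_of_eq hne ?_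
      simp [Pi.single_eq_of_ne (Ne.symm ha.1), Pi.single_eq_of_ne (Ne.symm ha.2), hij]

lemma sum_tupleDeg_sub_single_two_pow (k : ℕ) {m : ℕ} {x : Fin m → ℤ}
    (hx : ((m.choose 2 : ℕ) : ℤ) + 2 ^ k ≤ ∑ i, x i) :
    ∑ i, tupleDeg (x - Pi.single i (2 ^ k : ℤ)) = tupleDeg x := by
  induction k generalizing x with
  | zero => exact sum_tupleDeg_sub_single_one (by simpa using hx)
  | succ k ih =>
    have hpos : (0 : ℤ) < 2 ^ k := by positivity
    rw [pow_succ] at hx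
    have h1 : ∀ i, tupleDeg (x - Pi.single i (2 ^ (k + 1) : ℤ)) =
        tupleDeg (x - Pi.single i (2 ^ k : ℤ) - Pi.single i (2 ^ k : ℤ)) := by
      intro i
      rw [sub_sub, ← Pi.single_add, pow_succ, mul_two]
    have h2 := sum_sum_eq_sum_diag Finset.univ
      (fun i j => tupleDeg (x - Pi.single i (2 ^ k : ℤ) - Pi.single j (2 ^ k : ℤ)))
      (fun i j => by rw [sub_right_comm])
    rw [Finset.sum_congr rfl fun i _ => h1 i, ← h2, ← ih (x := x) (by omega)]
    refine Finset.sum_congr rfl fun i _ => ih ?_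
    simp only [Pi.sub_apply, Finset.sum_sub_distrib, Finset.sum_pi_single', Finset.mem_univ,
      if_true]
    omega

/-- Modulo 2, the degree of a partition is the sum of the degrees of the partitions obtained by
removing a `2 ^ k`-hook. -/
lemma degSYT_partOfBeta_two_pow {k : ℕ} {S : Finset ℕ} (h : 2 ^ k ≤ (partOfBeta S).sum) :
    (degSYT (partOfBeta S) : ZMod 2) =
      ∑ x ∈ movable S (2 ^ k), (degSYT (partOfBeta (moveBead S (2 ^ k) x)) : ZMod 2) := by
  obtain ⟨m, y, hinj, rfl⟩ : ∃ (m : ℕ) (y : Fin m → ℕ), Function.Injective y ∧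
      Finset.univ.image y = S :=
    ⟨S.card, S.orderEmbOfFin rfl, (S.orderEmbOfFin rfl).injective, by simp⟩
  rw [← sum_tupleDeg_natCast (Nat.two_pow_pos k) hinj, ← tupleDeg_natCast hinj]
  push_cast
  refine (sum_tupleDeg_sub_single_two_pow k ?_).symm
  have hs := sum_partOfBeta (Finset.univ.image y)
  rw [Finset.card_image_of_injective _ hinj, Finset.card_univ, Fintype.card_fin,
    Finset.sum_image fun i _ j _ h => hinj h] at hs
  exact_mod_cast (by omega : m.choose 2 + 2 ^ k ≤ ∑ i, y i)

/-- The set of beads obtained by shifting `S` by one and adding a bead at `0`. -/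
def shiftBeads (S : Finset ℕ) : Finset ℕ :=
  insert 0 (S.image (· + 1))

lemma succ_mem_shiftBeads {S : Finset ℕ} {x : ℕ} : x + 1 ∈ shiftBeads S ↔ x ∈ S := by
  simp [shiftBeads]

lemma betaSet_succ {lam : Multiset ℕ} {m : ℕ} (hm : Multiset.card lam ≤ m) :
    betaSet lam (m + 1) = shiftBeads (betaSet lam m) := by
  have hlen : (descList lam).length ≤ m := by simpa [descList] using hm
  rw [betaSet, Finset.range_add_one, Finset.image_insert, List.getD_eq_default _ _ hlen, shiftBeads,
    betaSet, Finset.image_image]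
  congr 1
  · omega
  · refine Finset.image_congr fun i hi => ?_
    have hi' : i < m := by simpa using hi
    simp only [Function.comp]
    omega

lemma partOfBeta_shiftBeads (S : Finset ℕ) : partOfBeta (shiftBeads S) = partOfBeta S := by
  have hle := card_partOfBeta_le S
  have h := partOfBeta_betaSet (m := S.card + 1) (fun _ => pos_of_mem_partOfBeta)
    (hle.trans (by omega))
  rwa [betaSet_succ hle, betaSet_partOfBeta] at h

lemma moveBead_shiftBeads {S : Finset ℕ} {e x : ℕ} (h : e ≤ x) :
    moveBead (shiftBeads S) e (x + 1) = shiftBeads (moveBead S e x) := by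
  ext b
  cases b with
  | zero => simp [moveBead, shiftBeads]
  | succ b =>
    rw [succ_mem_shiftBeads]
    simp only [moveBead, Finset.mem_insert, Finset.mem_erase, succ_mem_shiftBeads]
    grind

lemma exists_movable_shiftBeads_iff {S : Finset ℕ} {e : ℕ} (he : 0 < e) (mu : Multiset ℕ) :
    (∃ x ∈ movable (shiftBeads S) e, mu = partOfBeta (moveBead (shiftBeads S) e x)) ↔
      ∃ x ∈ movable S e, mu = partOfBeta (moveBead S e x) := by
  constructor
  · rintro ⟨x, hx, rfl⟩
    obtain ⟨h1, h2, h3⟩ := mem_movable.1 hx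
    obtain ⟨y, rfl⟩ : ∃ y, x = y + 1 := ⟨x - 1, by omega⟩
    have hey : e ≤ y := by
      by_contra hlt
      have h0 : y + 1 - e = 0 := by omega
      exact h3 (h0 ▸ Finset.mem_insert_self _ _)
    refine ⟨y, mem_movable.2 ⟨succ_mem_shiftBeads.1 h1, hey, fun h => h3 ?_⟩, ?_⟩
    · rw [Nat.sub_add_comm hey]
      exact succ_mem_shiftBeads.2 h
    · rw [moveBead_shiftBeads hey, partOfBeta_shiftBeads]
  · rintro ⟨x, hx, rfl⟩
    obtain ⟨h1, h2, h3⟩ := mem_movable.1 hx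
    refine ⟨x + 1, mem_movable.2 ⟨succ_mem_shiftBeads.2 h1, by omega, ?_⟩, ?_⟩
    · rw [Nat.sub_add_comm h2, succ_mem_shiftBeads]
      exact h3
    · rw [moveBead_shiftBeads h2, partOfBeta_shiftBeads]

lemma isHookRemoval_partOfBeta_iff {S : Finset ℕ} {e : ℕ} (he : 0 < e) {mu : Multiset ℕ} :
    IsHookRemoval e (partOfBeta S) mu ↔
      ∃ x ∈ movable S e, mu = partOfBeta (moveBead S e x) := by
  have hle := card_partOfBeta_le S
  constructor
  · rintro ⟨-, hmu, -, m, x, hm, hm', hx, hex, hxe, hbeta⟩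
    have key : ∀ a, Multiset.card (partOfBeta S) ≤ a →
        ((∃ x ∈ movable (betaSet (partOfBeta S) a) e,
            mu = partOfBeta (moveBead (betaSet (partOfBeta S) a) e x)) ↔
          ∃ x ∈ movable (betaSet (partOfBeta S) (Multiset.card (partOfBeta S))) e,
            mu = partOfBeta
              (moveBead (betaSet (partOfBeta S) (Multiset.card (partOfBeta S))) e x)) := by
      intro a ha
      induction a, ha using Nat.le_induction with
      | base => rfl
      | succ a ha ih => rw [betaSet_succ ha, exists_movable_shiftBeads_iff he, ih]
    have h1 := (key m hm).1 ⟨x, mem_movable.2 ⟨hx, hex, hxe⟩, by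
      rw [moveBead, ← hbeta, partOfBeta_betaSet hmu hm']⟩
    have h2 := (key _ hle).2 h1
    rwa [betaSet_partOfBeta] at h2
  · rintro ⟨x, hx, rfl⟩
    obtain ⟨h1, h2, h3⟩ := mem_movable.1 hx
    refine ⟨fun _ => pos_of_mem_partOfBeta, fun _ => pos_of_mem_partOfBeta, he, S.card, x, hle,
      (card_partOfBeta_le _).trans (card_moveBead hx).le, ?_, h2, ?_, ?_⟩
    · rwa [betaSet_partOfBeta]
    · rwa [betaSet_partOfBeta]
    · rw [betaSet_partOfBeta]
      conv_lhs => rw [← card_moveBead hx, betaSet_partOfBeta]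
      rfl

lemma oddP_partOfBeta_iff {S : Finset ℕ} :
    OddP (partOfBeta S) ↔ (degSYT (partOfBeta S) : ZMod 2) = 1 := by
  rw [OddP, ZMod.natCast_eq_one_iff_odd]
  exact and_iff_right fun _ => pos_of_mem_partOfBeta

/-- On odd partitions of size at least `2 ^ k`, the map `fkOp k` removes a `2 ^ k`-hook and its
value is odd. -/
lemma exists_fkOp_partOfBeta {k : ℕ} {S : Finset ℕ} (hodd : OddP (partOfBeta S))
    (h : 2 ^ k ≤ (partOfBeta S).sum) :
    ∃ x ∈ movable S (2 ^ k), fkOp k (partOfBeta S) = partOfBeta (moveBead S (2 ^ k) x) ∧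
      OddP (partOfBeta (moveBead S (2 ^ k) x)) := by
  have hex : ∃ mu, IsHookRemoval (2 ^ k) (partOfBeta S) mu ∧ OddP mu := by
    have h1 := degSYT_partOfBeta_two_pow h
    rw [oddP_partOfBeta_iff.1 hodd] at h1
    obtain ⟨x, hx, hne⟩ := Finset.exists_ne_zero_of_sum_ne_zero (h1 ▸ one_ne_zero)
    refine ⟨partOfBeta (moveBead S (2 ^ k) x),
      (isHookRemoval_partOfBeta_iff (Nat.two_pow_pos k)).2 ⟨x, hx, rfl⟩,
      oddP_partOfBeta_iff.2 ?_⟩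
    exact Fin.eq_one_of_ne_zero _ hne
  have hfk : fkOp k (partOfBeta S) = hex.choose := dif_pos hex
  obtain ⟨h1, h2⟩ := hex.choose_spec
  obtain ⟨x, hx, hmu⟩ := (isHookRemoval_partOfBeta_iff (Nat.two_pow_pos k)).1 h1
  exact ⟨x, hx, hfk.trans hmu, hmu ▸ h2⟩

/-- Two finite sets of beads which are closed under subtracting `e` and have equally many beads in
each residue class modulo `e` coincide. -/
lemma eq_of_closed_sub {e : ℕ} (he : 0 < e) {A B : Finset ℕ} (hA : ∀ x ∈ A, e ≤ x → x - e ∈ A)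
    (hB : ∀ x ∈ B, e ≤ x → x - e ∈ B)
    (h : ∀ r, (A.filter (fun x => x % e = r)).card = (B.filter (fun x => x % e = r)).card) :
    A = B := by
  have hsub : ∀ {C : Finset ℕ}, (∀ x ∈ C, e ≤ x → x - e ∈ C) →
      ∀ {a b : ℕ}, b ∈ C → a ≤ b → a % e = b % e → a ∈ C := by
    intro C hC a b
    induction b using Nat.strong_induction_on with
    | _ b ih =>
      intro hb hab hmod
      rcases hab.eq_or_lt with rfl | hlt
      · exact hb
      · have h1 : e ≤ b - a := by
          refine Nat.le_of_dvd (by omega) ?_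
          exact (Nat.modEq_iff_dvd' hab).1 hmod
        refine ih (b - e) (by omega) (hC b hb (by omega)) (by omega) ?_
        rw [hmod, ← Nat.mod_eq_sub_mod (by omega)]
  have hfilter : ∀ r, A.filter (fun x => x % e = r) = B.filter (fun x => x % e = r) := by
    intro r
    by_cases h1 : A.filter (fun x => x % e = r) ⊆ B.filter (fun x => x % e = r)
    · exact Finset.eq_of_subset_of_card_le h1 (h r).ge
    · obtain ⟨a, ha, ha'⟩ := Finset.not_subset.1 h1
      obtain ⟨haA, har⟩ := Finset.mem_filter.1 ha
      refine (Finset.eq_of_subset_of_card_le (fun b hb => ?_) (h r).le).symm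
      obtain ⟨hbB, hbr⟩ := Finset.mem_filter.1 hb
      refine Finset.mem_filter.2 ⟨?_, hbr⟩
      rcases le_total b a with hba | hab
      · exact hsub hA haA hba (hbr.trans har.symm)
      · exact absurd (Finset.mem_filter.2 ⟨hsub hB hbB hab (har.trans hbr.symm), har⟩) ha'
  ext x
  have := congrArg (fun C => x ∈ C) (hfilter (x % e))
  simpa using this

lemma card_filter_mod_moveBead {S : Finset ℕ} {d e x : ℕ} (hx : x ∈ movable S d) (hed : e ∣ d)
    (r : ℕ) : ((moveBead S d x).filter (fun y => y % e = r)).card =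
      (S.filter (fun y => y % e = r)).card := by
  obtain ⟨h1, h2, h3⟩ := mem_movable.1 hx
  have hmod : (x - d) % e = x % e := by
    obtain ⟨c, rfl⟩ := hed
    exact Nat.sub_mul_mod h2
  rw [moveBead, Finset.filter_insert, Finset.filter_erase, hmod]
  split_ifs with hr
  · rw [Finset.card_insert_of_notMem (by simp [h3]), Finset.card_erase_add_one (by simp [h1, hr])]
  · rw [Finset.erase_eq_of_notMem (by simp [hr])]

lemma sub_mem_of_sum_partOfBeta_lt {S : Finset ℕ} {e : ℕ} (h : (partOfBeta S).sum < e) :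
    ∀ x ∈ S, e ≤ x → x - e ∈ S := by
  intro x hx hex
  by_contra hn
  have := sum_partOfBeta_moveBead (mem_movable.2 ⟨hx, hex, hn⟩)
  omega

lemma fkOp_fkOp_of_lt {k m : ℕ} (hm : m < 2 ^ k) {lam : Multiset ℕ} (hodd : OddP lam)
    (hsum : lam.sum = 2 ^ (k + 1) + m) : fkOp k (fkOp k lam) = fkOp (k + 1) lam := by
  obtain ⟨S, rfl⟩ : ∃ S, partOfBeta S = lam := ⟨_, partOfBeta_betaSet hodd.1 le_rfl⟩
  have hpow : 2 ^ (k + 1) = 2 ^ k + 2 ^ k := by ring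
  obtain ⟨x, hx, hfx, hox⟩ := exists_fkOp_partOfBeta (k := k) hodd (by omega)
  have hsx := sum_partOfBeta_moveBead hx
  obtain ⟨y, hy, hfy, -⟩ := exists_fkOp_partOfBeta (k := k) hox (by omega)
  have hsy := sum_partOfBeta_moveBead hy
  obtain ⟨z, hz, hfz, -⟩ := exists_fkOp_partOfBeta (k := k + 1) hodd (by omega)
  have hsz := sum_partOfBeta_moveBead hz
  rw [hfx, hfy, hfz]
  congr 1
  refine eq_of_closed_sub (Nat.two_pow_pos k) (sub_mem_of_sum_partOfBeta_lt (by omega))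
    (sub_mem_of_sum_partOfBeta_lt (by omega)) fun r => ?_
  rw [card_filter_mod_moveBead hy dvd_rfl, card_filter_mod_moveBead hx dvd_rfl,
    card_filter_mod_moveBead hz (pow_dvd_pow 2 k.le_succ)]

lemma degSYT_singleton (p : ℕ) (hp : 0 < p) : degSYT {p} = 1 := by
  induction p with
  | zero => omega
  | succ p ih =>
    have h1 : (({p + 1} : Multiset ℕ).toFinset.filter (fun p => 0 < p)) = {p + 1} := by
      ext a
      simp only [Finset.mem_filter, Multiset.toFinset_singleton, Finset.mem_singleton]
      omega
    rw [degSYT, dif_neg (Multiset.singleton_ne_zero _),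
      Finset.sum_attach _ (fun q => degSYT (removeBox {p + 1} q)), h1, Finset.sum_singleton,
      removeBox]
    split_ifs with h
    · rw [Multiset.erase_singleton, degSYT, dif_pos rfl]
    · rw [Multiset.erase_singleton, Nat.add_sub_cancel]
      exact ih (by omega)

/-- A set of `j + 2` beads for the partition with the single part `T - (j + 1)`. -/
def rowBeads (j T : ℕ) : Finset ℕ :=
  insert T (Finset.range (j + 1))

lemma partOfBeta_rowBeads {j T : ℕ} (h : j < T) : partOfBeta (rowBeads j T) =
    if 0 < T - (j + 1) then {T - (j + 1)} else 0 := by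
  rw [rowBeads, partOfBeta_insert_max (fun b hb => by simp at hb; omega), partOfBeta_range,
    Finset.card_range]
  rfl

lemma degSYT_rowBeads {j T : ℕ} (h : j < T) : degSYT (partOfBeta (rowBeads j T)) = 1 := by
  rw [partOfBeta_rowBeads h]
  split_ifs with h'
  · exact degSYT_singleton _ h'
  · rw [degSYT, dif_pos rfl]

lemma sum_partOfBeta_rowBeads {j T : ℕ} (h : j < T) :
    (partOfBeta (rowBeads j T)).sum = T - (j + 1) := by
  rw [partOfBeta_rowBeads h]
  split_ifs with h'
  · simp
  · simp only [Multiset.sum_zero]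
    omega

/-- A set of `j + 2` beads for the partition `(T - (j + 1), e - j, 1 ^ j)`, if `j < e < T`. -/
def wrapBeads (e j T : ℕ) : Finset ℕ :=
  insert T (insert e (Finset.Icc 1 j))

lemma mem_wrapBeads {e j T x : ℕ} : x ∈ wrapBeads e j T ↔ x = T ∨ x = e ∨ 1 ≤ x ∧ x ≤ j := by
  simp [wrapBeads]

lemma mem_rowBeads {j T x : ℕ} : x ∈ rowBeads j T ↔ x = T ∨ x ≤ j := by
  simp [rowBeads]

lemma self_mem_movable_wrapBeads {e j T : ℕ} (hj : j < e) (hT : j < T) :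
    e ∈ movable (wrapBeads e j T) e := by
  rw [mem_movable, mem_wrapBeads, mem_wrapBeads]
  omega

lemma moveBead_wrapBeads_self {e j T : ℕ} (hj : j < e) (hTe : T ≠ e) :
    moveBead (wrapBeads e j T) e e = rowBeads j T := by
  ext x
  simp only [moveBead, Finset.mem_insert, Finset.mem_erase, mem_wrapBeads, mem_rowBeads]
  omega

lemma moveBead_wrapBeads_last {e j T d : ℕ} (hjT : j < T) (hTe : T ≠ e) :
    moveBead (wrapBeads e j T) d T = wrapBeads e j (T - d) := by
  ext x
  simp only [moveBead, Finset.mem_insert, Finset.mem_erase, mem_wrapBeads]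
  omega

lemma sum_partOfBeta_wrapBeads {e j T : ℕ} (hj : j < e) (hjT : j < T) (hTe : T ≠ e) :
    (partOfBeta (wrapBeads e j T)).sum = T - (j + 1) + e := by
  rw [← sum_partOfBeta_moveBead (self_mem_movable_wrapBeads hj hjT),
    moveBead_wrapBeads_self hj hTe, sum_partOfBeta_rowBeads hjT]

lemma degSYT_wrapBeads_of_stuck {k j T : ℕ} (hj : j < 2 ^ k) (hjT : j < T) (hTe : T ≠ 2 ^ k)
    (h : 2 ^ k ≤ T → T - 2 ^ k ∈ wrapBeads (2 ^ k) j T) :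
    (degSYT (partOfBeta (wrapBeads (2 ^ k) j T)) : ZMod 2) = 1 := by
  have hmov : movable (wrapBeads (2 ^ k) j T) (2 ^ k) = {2 ^ k} := by
    ext x
    rw [Finset.mem_singleton]
    constructor
    · intro hx
      obtain ⟨h1, h2, h3⟩ := mem_movable.1 hx
      rcases mem_wrapBeads.1 h1 with rfl | h1 | h1
      · exact absurd (h h2) h3
      · exact h1
      · omega
    · rintro rfl
      exact self_mem_movable_wrapBeads hj hjT
  rw [degSYT_partOfBeta_two_pow (k := k) (by rw [sum_partOfBeta_wrapBeads hj hjT hTe]; omega), hmov,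
    Finset.sum_singleton, moveBead_wrapBeads_self hj hTe, degSYT_rowBeads hjT, Nat.cast_one]

lemma degSYT_wrapBeads {k j T : ℕ} (hj : j < 2 ^ k) (hT : 2 ^ k < T)
    (h : T - 2 ^ k ∉ wrapBeads (2 ^ k) j T) :
    (degSYT (partOfBeta (wrapBeads (2 ^ k) j T)) : ZMod 2) =
      degSYT (partOfBeta (wrapBeads (2 ^ k) j (T - 2 ^ k))) + 1 := by
  have hjT : j < T := hj.trans hT
  have hmov : movable (wrapBeads (2 ^ k) j T) (2 ^ k) = {T, 2 ^ k} := by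
    ext x
    rw [Finset.mem_insert, Finset.mem_singleton]
    constructor
    · intro hx
      obtain ⟨h1, h2, h3⟩ := mem_movable.1 hx
      rcases mem_wrapBeads.1 h1 with h1 | h1 | h1 <;> omega
    · rintro (rfl | rfl)
      · exact mem_movable.2 ⟨mem_wrapBeads.2 (Or.inl rfl), hT.le, h⟩
      · exact self_mem_movable_wrapBeads hj hjT
  rw [degSYT_partOfBeta_two_pow (k := k) (by rw [sum_partOfBeta_wrapBeads hj hjT hT.ne']; omega),
    hmov, Finset.sum_pair hT.ne', moveBead_wrapBeads_self hj hT.ne',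
    moveBead_wrapBeads_last hjT hT.ne', degSYT_rowBeads hjT, Nat.cast_one]

lemma degSYT_wrapBeads_add_mul {k j T : ℕ} (hj : j < 2 ^ k) (hT : 2 ^ k < T) (i : ℕ) :
    (degSYT (partOfBeta (wrapBeads (2 ^ k) j (T + i * 2 ^ k))) : ZMod 2) =
      degSYT (partOfBeta (wrapBeads (2 ^ k) j T)) + i := by
  induction i with
  | zero => simp
  | succ i ih =>
    have hsub : T + (i + 1) * 2 ^ k = T + i * 2 ^ k + 2 ^ k := by ring
    have hnot : T + (i + 1) * 2 ^ k - 2 ^ k ∉ wrapBeads (2 ^ k) j (T + (i + 1) * 2 ^ k) := by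
      rw [mem_wrapBeads]
      omega
    rw [degSYT_wrapBeads hj (by omega) hnot, hsub, Nat.add_sub_cancel, ih]
    push_cast
    ring

/-- If `3 * 2 ^ k ≤ n`, then some partition of `n` of the form `(n - 2 ^ k, 2 ^ k - j, 1 ^ j)` is
odd. -/
lemma exists_oddP_wrapBeads {k n : ℕ} (hk : 0 < k) (h : 3 * 2 ^ k ≤ n) :
    ∃ j T, j < 2 ^ k ∧ T + 2 ^ k = n + (j + 1) ∧ OddP (partOfBeta (wrapBeads (2 ^ k) j T)) := by
  have he : 2 ≤ 2 ^ k := by simpa using Nat.pow_le_pow_right two_pos hk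
  obtain ⟨i, r, hr, rfl⟩ : ∃ i r, r < 2 ^ k ∧ n = i * 2 ^ k + r + 2 * 2 ^ k := by
    refine ⟨(n - 2 * 2 ^ k) / 2 ^ k, (n - 2 * 2 ^ k) % 2 ^ k, Nat.mod_lt _ (by omega), ?_⟩
    rw [Nat.div_add_mod']
    omega
  have hadd : (i + 1) * 2 ^ k = i * 2 ^ k + 2 ^ k := by ring
  rcases Nat.even_or_odd i with hi | hi
  · have hi0 : (i : ZMod 2) = 0 := ZMod.natCast_eq_zero_iff_even.2 hi
    refine ⟨2 ^ k - 1 - r, 2 * 2 ^ k + i * 2 ^ k, by omega, by omega, oddP_partOfBeta_iff.2 ?_⟩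
    rw [degSYT_wrapBeads_add_mul (by omega) (by omega), hi0, add_zero]
    refine degSYT_wrapBeads_of_stuck (by omega) (by omega) (by omega) fun _ => ?_
    rw [mem_wrapBeads]
    omega
  · have hi1 : (i : ZMod 2) = 1 := ZMod.natCast_eq_one_iff_odd.2 hi
    by_cases hre : r + 1 = 2 ^ k
    · refine ⟨1, 2 ^ k + 1 + (i + 1) * 2 ^ k, by omega, by omega, oddP_partOfBeta_iff.2 ?_⟩
      rw [degSYT_wrapBeads_add_mul (by omega) (by omega), Nat.cast_add, hi1, Nat.cast_one,
        CharTwo.add_self_eq_zero, add_zero]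
      refine degSYT_wrapBeads_of_stuck (by omega) (by omega) (by omega) fun _ => ?_
      rw [mem_wrapBeads]
      omega
    · refine ⟨0, 2 ^ k + (r + 1) + i * 2 ^ k, by omega, by omega, oddP_partOfBeta_iff.2 ?_⟩
      have hnot : 2 ^ k + (r + 1) - 2 ^ k ∉ wrapBeads (2 ^ k) 0 (2 ^ k + (r + 1)) := by
        rw [mem_wrapBeads]
        omega
      rw [degSYT_wrapBeads_add_mul (by omega) (by omega), hi1,
        degSYT_wrapBeads (by omega) (by omega) hnot, Nat.add_sub_cancel_left,
        degSYT_wrapBeads_of_stuck (by omega) (by omega) (by omega) fun _ => by omega,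
        CharTwo.add_self_eq_zero, zero_add]

lemma fkOp_fkOp_wrapBeads_ne {k j T : ℕ} (hj : j < 2 ^ k) (hT : 2 * 2 ^ k + j < T)
    (hodd : OddP (partOfBeta (wrapBeads (2 ^ k) j T))) :
    fkOp k (fkOp k (partOfBeta (wrapBeads (2 ^ k) j T))) ≠
      fkOp (k + 1) (partOfBeta (wrapBeads (2 ^ k) j T)) := by
  have hpow : 2 ^ (k + 1) = 2 * 2 ^ k := by ring
  have hjT : j < T := by omega
  have hTe : T ≠ 2 ^ k := by omega
  have hsum := sum_partOfBeta_wrapBeads hj hjT hTe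
  have hfirst : fkOp k (partOfBeta (wrapBeads (2 ^ k) j T)) = partOfBeta (rowBeads j T) := by
    obtain ⟨x, hx, hfx, hox⟩ := exists_fkOp_partOfBeta (k := k) hodd (by omega)
    obtain ⟨h1, h2, h3⟩ := mem_movable.1 hx
    rcases mem_wrapBeads.1 h1 with rfl | rfl | h1
    · have hrec := degSYT_wrapBeads hj (by omega) h3
      rw [moveBead_wrapBeads_last hjT hTe] at hox
      rw [oddP_partOfBeta_iff.1 hodd, oddP_partOfBeta_iff.1 hox, CharTwo.add_self_eq_zero] at hrec
      exact absurd hrec one_ne_zero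
    · rw [hfx, moveBead_wrapBeads_self hj hTe]
    · omega
  have hrow : OddP (partOfBeta (rowBeads j T)) := by
    rw [oddP_partOfBeta_iff, degSYT_rowBeads hjT, Nat.cast_one]
  have hrowsum := sum_partOfBeta_rowBeads hjT
  have hsecond : fkOp k (partOfBeta (rowBeads j T)) =
      partOfBeta (moveBead (rowBeads j T) (2 ^ k) T) ∧ T ∈ movable (rowBeads j T) (2 ^ k) := by
    obtain ⟨x, hx, hfx, -⟩ := exists_fkOp_partOfBeta (k := k) hrow (by omega)
    obtain ⟨h1, h2, h3⟩ := mem_movable.1 hx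
    rcases mem_rowBeads.1 h1 with rfl | h1
    · exact ⟨hfx, hx⟩
    · omega
  obtain ⟨y, hy, hfy, -⟩ := exists_fkOp_partOfBeta (k := k + 1) hodd (by omega)
  obtain ⟨h1, h2, h3⟩ := mem_movable.1 hy
  obtain rfl : y = T := by
    rcases mem_wrapBeads.1 h1 with h1 | h1 | h1 <;> omega
  rw [hfirst, hsecond.1, hfy]
  intro heq
  have hcard : (rowBeads j y).card = (wrapBeads (2 ^ k) j y).card := by
    rw [← moveBead_wrapBeads_self hj hTe, card_moveBead (self_mem_movable_wrapBeads hj hjT)]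
  have hset := partOfBeta_injective
    (by rw [card_moveBead hsecond.2, card_moveBead hy, hcard]) heq
  have h0 : 0 ∈ moveBead (rowBeads j y) (2 ^ k) y := by
    simp only [moveBead, Finset.mem_insert, Finset.mem_erase, mem_rowBeads]
    omega
  rw [hset, moveBead_wrapBeads_last hjT hTe, mem_wrapBeads] at h0
  omega

theorem stmt14 (k n : ℕ) (hk : 0 < k) (h : 2 ^ (k + 1) ≤ n) :
    (∀ lam : Multiset ℕ, OddP lam → lam.sum = n →
      fkOp k (fkOp k lam) = fkOp (k + 1) lam) ↔
    (∃ m, m < 2 ^ k ∧ n = 2 ^ (k + 1) + m) := by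
  constructor
  · intro hall
    refine ⟨n - 2 ^ (k + 1), ?_, by omega⟩
    by_contra hlt
    have hpow : 2 ^ (k + 1) = 2 * 2 ^ k := by ring
    obtain ⟨j, T, hj, hT, hodd⟩ := exists_oddP_wrapBeads (n := n) hk (by omega)
    refine fkOp_fkOp_wrapBeads_ne hj (by omega) hodd (hall _ hodd ?_)
    rw [sum_partOfBeta_wrapBeads hj (by omega) (by omega)]
    omega
  · rintro ⟨m, hm, rfl⟩ lam hodd hsum
    exact fkOp_fkOp_of_lt hm hodd hsum

end OddSym
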